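/- Consider a k-QSAT polynomial system with M ≥ 1 clauses on N variables given by a neighborhood map e : Fin M → Fin k → Fin N with e m injective for every m, with coefficients φ : Fin M → ((Fin k → Fin 2) → ℂ). Fix a ∈ ℂ, and let φ_a denote the coefficient family obtained from φ by replacing the constant term of the first clause: φ_a 0 (fun _ => 0) = φ 0 (fun _ => 0) + a, and φ_a m i = φ m i for all other pairs (m, i). Then for volume-almost every φ, if the system with coefficients φ has a common solution z : Fin N → ℂ (all clause equations vanish at z), then the system with coefficients φ_a also has a common solution. -/

import Mathlib

open MeasureTheory

/-- A real-analytic function on a finite-dimensional space that does not vanish identically is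
nonzero almost everywhere. -/
theorem AnalyticOnNhd.ae_ne_zero {E F : Type*} [NormedAddCommGroup E] [NormedSpace ℝ E]
    [FiniteDimensional ℝ E] [MeasurableSpace E] [BorelSpace E]
    [NormedAddCommGroup F] [NormedSpace ℝ F] (μ : Measure E) [μ.IsAddHaarMeasure]
    {f : E → F} (hf : AnalyticOnNhd ℝ f Set.univ) {x₀ : E} (hx₀ : f x₀ ≠ 0) :
    ∀ᵐ x ∂μ, f x ≠ 0 := by
  have hcont : Continuous f := continuousOn_univ.mp hf.continuousOn
  have hline (y : E) : ∀ᵐ t : ℝ, f (x₀ + t • y) ≠ 0 := by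
    have han : AnalyticOnNhd ℝ (fun t : ℝ => f (x₀ + t • y)) Set.univ := fun t _ =>
      (hf (x₀ + t • y) trivial).fun_comp (f := fun t : ℝ => x₀ + t • y) (by fun_prop)
    have hmem := han.preimage_zero_mem_codiscrete (x := 0) (by simpa using hx₀)
    have hle := ae_restrict_le_codiscreteWithin (μ := (volume : Measure ℝ)) (U := Set.univ)
      MeasurableSet.univ
    rw [Measure.restrict_univ] at hle
    exact hle hmem
  have hmeas : MeasurableSet {p : E × ℝ | f (x₀ + p.2 • p.1) ≠ 0} :=
    (isOpen_ne_fun (by fun_prop) continuous_const).measurableSet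
  have hswap : ∀ᵐ t : ℝ, ∀ᵐ y ∂μ, f (x₀ + t • y) ≠ 0 :=
    (Measure.ae_ae_comm (μ := μ) (ν := (volume : Measure ℝ)) hmeas).mp (.of_forall hline)
  obtain ⟨t, ht, ht0⟩ := (hswap.and (Measure.ae_ne volume (0 : ℝ))).exists
  have hnull : μ ((t • ·) ⁻¹' {y | ¬ f (x₀ + y) ≠ 0}) = 0 := ht
  rw [Measure.addHaar_preimage_smul μ ht0, mul_eq_zero] at hnull
  have hshift : ∀ᵐ y ∂μ, f (x₀ + y) ≠ 0 :=
    hnull.resolve_left (by simp [ht0])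
  simpa using ((measurePreserving_add_left μ (-x₀)).quasiMeasurePreserving.ae hshift)

/-- Over a domain, every constructible subset of the spectrum either contains or avoids some
nonempty basic open set. -/
theorem PrimeSpectrum.exists_basicOpen_subset_or_subset_compl {R : Type*} [CommRing R] [IsDomain R]
    {T : Set (PrimeSpectrum R)} (hT : Topology.IsConstructible T) :
    ∃ g : R, g ≠ 0 ∧ ((basicOpen g : Set (PrimeSpectrum R)) ⊆ T ∨
      (basicOpen g : Set (PrimeSpectrum R)) ⊆ Tᶜ) := by
  induction hT using Topology.IsConstructible.empty_union_induction with
  | open_retrocompact U hU _ =>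
    rcases U.eq_empty_or_nonempty with rfl | ⟨x, hx⟩
    · exact ⟨1, one_ne_zero, by simp⟩
    · obtain ⟨_, ⟨g, rfl⟩, hxg, hg⟩ := isTopologicalBasis_basic_opens.exists_subset_of_mem_open hx hU
      refine ⟨g, ?_, Or.inl hg⟩
      rintro rfl
      simp at hxg
  | union s _ t _ hs ht =>
    obtain ⟨g, hg, hgs⟩ := hs
    obtain ⟨h, hh, hht⟩ := ht
    refine ⟨g * h, mul_ne_zero hg hh, ?_⟩
    have hl := basicOpen_mul_le_left g h
    have hr := basicOpen_mul_le_right g h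
    rcases hgs with hgs | hgs
    · exact Or.inl ((Set.Subset.trans hl hgs).trans Set.subset_union_left)
    rcases hht with hht | hht
    · exact Or.inl ((Set.Subset.trans hr hht).trans Set.subset_union_right)
    · rw [Set.compl_union]
      exact Or.inr (Set.subset_inter (Set.Subset.trans hl hgs) (Set.Subset.trans hr hht))
  | compl s _ hs =>
    obtain ⟨g, hg, hgs⟩ := hs
    exact ⟨g, hg, by rw [compl_compl]; exact hgs.symm⟩

namespace MvPolynomial

variable {K σ τ ι : Type*} [Field K] [IsAlgClosed K] [Finite τ]

/-- A specialization of a polynomial system over an algebraically closed field is solvable iff the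
corresponding point of the parameter space lies in the image of the incidence scheme. -/
theorem exists_eval_map_eq_zero_iff_mem_image_comap
    (F : ι → MvPolynomial τ (MvPolynomial σ K)) (x : σ → K) :
    (∃ z : τ → K, ∀ m, eval z (map (eval x) (F m)) = 0) ↔
      (PrimeSpectrum.comap (eval x) ⊥ : PrimeSpectrum (MvPolynomial σ K)) ∈
        PrimeSpectrum.comap C '' PrimeSpectrum.zeroLocus (Set.range F) := by
  constructor
  · rintro ⟨z, hz⟩
    refine ⟨PrimeSpectrum.comap ((eval z).comp (map (eval x))) ⊥, ?_, ?_⟩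
    · rintro _ ⟨m, rfl⟩
      exact hz m
    · rw [← PrimeSpectrum.comap_comp_apply]
      congr 1
      ext <;> simp
  · rintro ⟨q, hq, hqx⟩
    have hker : RingHom.ker (map (eval x) : MvPolynomial τ (MvPolynomial σ K) →+* _) ≤
        q.asIdeal := by
      rw [ker_map, Ideal.map_le_iff_le_comap]
      exact (congrArg PrimeSpectrum.asIdeal hqx).ge
    have hsurj : Function.Surjective
        (map (eval x) : MvPolynomial τ (MvPolynomial σ K) →+* MvPolynomial τ K) :=
      map_surjective _ fun c => ⟨C c, eval_C c⟩
    have hprime := Ideal.map_isPrime_of_surjective hsurj hker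
    obtain ⟨I, hI, hqI⟩ := Ideal.exists_le_maximal _ hprime.ne_top
    obtain ⟨z, rfl⟩ := isMaximal_iff_eq_vanishingIdeal_singleton.mp hI
    refine ⟨z, fun m => ?_⟩
    have := hqI (Ideal.mem_map_of_mem _ (hq ⟨m, rfl⟩))
    simpa [mem_vanishingIdeal_singleton_iff, aeval_eq_eval] using this

/-- Solvability of a finite polynomial system over an algebraically closed field is constant on the
complement of some hypersurface in the parameter space. -/
theorem exists_ne_zero_forall_eval_ne_zero_solvable_or_not [Finite ι]
    (F : ι → MvPolynomial τ (MvPolynomial σ K)) :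
    ∃ g : MvPolynomial σ K, g ≠ 0 ∧
      ((∀ x, eval x g ≠ 0 → ∃ z : τ → K, ∀ m, eval z (map (eval x) (F m)) = 0) ∨
        ∀ x, eval x g ≠ 0 → ¬ ∃ z : τ → K, ∀ m, eval z (map (eval x) (F m)) = 0) := by
  have hpres : (C : MvPolynomial σ K →+* MvPolynomial τ (MvPolynomial σ K)).FinitePresentation :=
    RingHom.finitePresentation_algebraMap.mpr inferInstance
  have hcon : Topology.IsConstructible
      (PrimeSpectrum.zeroLocus (Set.range F)) := by
    rw [← Topology.isConstructible_compl]
    exact (PrimeSpectrum.isRetrocompact_zeroLocus_compl (Set.finite_range F)).isConstructible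
      (PrimeSpectrum.isClosed_zeroLocus _).isOpen_compl
  obtain ⟨g, hg, h⟩ := PrimeSpectrum.exists_basicOpen_subset_or_subset_compl
    (PrimeSpectrum.isConstructible_comap_image hpres hcon)
  simp_rw [exists_eval_map_eq_zero_iff_mem_image_comap]
  exact ⟨g, hg, h.imp (fun h x hx => h hx) fun h x hx => h hx⟩

end MvPolynomial

/-- For almost every coefficient family, if the k-QSAT system has a common solution,
then so does the system obtained by shifting the constant term of the first clause
by any fixed `a ∈ ℂ`. -/
theorem solution_extension_constant_shift (k M N : ℕ) (hk : 0 < k) (hM : 0 < M) (hN : 0 < N)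
    (e : Fin M → Fin k → Fin N) (he : ∀ m, Function.Injective (e m)) (a : ℂ) :
    ∀ᵐ φ : Fin M → ((Fin k → Fin 2) → ℂ) ∂volume,
      (∃ z : Fin N → ℂ, ∀ m : Fin M,
        ∑ i : Fin k → Fin 2, φ m i * ∏ j : Fin k, (z (e m j)) ^ ((i j : ℕ)) = 0) →
      ∃ z : Fin N → ℂ, ∀ m : Fin M,
        ∑ i : Fin k → Fin 2,
          (if m = (⟨0, hM⟩ : Fin M) ∧ i = (fun _ => 0) then φ m i + a else φ m i) *
            ∏ j : Fin k, (z (e m j)) ^ ((i j : ℕ)) = 0 := by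
  let F (m : Fin M) : MvPolynomial (Fin N) (MvPolynomial (Fin M × (Fin k → Fin 2)) ℂ) :=
    ∑ i : Fin k → Fin 2, MvPolynomial.C (MvPolynomial.X (m, i)) *
      ∏ j : Fin k, MvPolynomial.X (e m j) ^ (i j : ℕ)
  obtain ⟨g, hg, h⟩ := MvPolynomial.exists_ne_zero_forall_eval_ne_zero_solvable_or_not F
  simp only [F, map_sum, map_mul, map_prod, map_pow, MvPolynomial.map_C, MvPolynomial.map_X,
    MvPolynomial.eval_C, MvPolynomial.eval_X] at h
  have hne : ∀ᵐ φ : Fin M → ((Fin k → Fin 2) → ℂ),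
      MvPolynomial.eval (fun p => φ p.1 p.2) g ≠ 0 := by
    obtain ⟨x, hx⟩ : ∃ x, MvPolynomial.eval x g ≠ 0 := by
      by_contra! hzero
      exact hg (MvPolynomial.funext fun x => by simpa using hzero x)
    have han : AnalyticOnNhd ℝ (fun φ : Fin M → (Fin k → Fin 2) → ℂ =>
        MvPolynomial.eval (fun p => φ p.1 p.2) g) Set.univ :=
      fun φ _ => AnalyticAt.aeval_mvPolynomial (𝕜 := ℝ) (A := ℂ) (B := ℂ)
        (f := fun (φ : Fin M → (Fin k → Fin 2) → ℂ) (p : Fin M × (Fin k → Fin 2)) => φ p.1 p.2)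
        (fun p => ((ContinuousLinearMap.proj (R := ℝ) (φ := fun _ => ℂ) p.2).comp
          (ContinuousLinearMap.proj (R := ℝ) (φ := fun _ => (Fin k → Fin 2) → ℂ) p.1)).analyticAt φ)
        g
    have : (volume : Measure ((Fin k → Fin 2) → ℂ)).IsAddHaarMeasure :=
      Measure.pi.isAddHaarMeasure _
    have : (volume : Measure (Fin M → (Fin k → Fin 2) → ℂ)).IsAddHaarMeasure :=
      Measure.pi.isAddHaarMeasure _
    exact han.ae_ne_zero volume (x₀ := fun m i => x (m, i)) hx
  rcases h with h | h
  · let b : Fin M → (Fin k → Fin 2) → ℂ :=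
      fun m i => if m = ⟨0, hM⟩ ∧ i = (fun _ => 0) then a else 0
    filter_upwards [(measurePreserving_add_right volume b).quasiMeasurePreserving.ae hne]
      with φ hφ _
    obtain ⟨z, hz⟩ := h _ hφ
    refine ⟨z, fun m => ?_⟩
    rw [← hz m]
    refine Finset.sum_congr rfl fun i _ => ?_
    congr 1
    simp only [b, Pi.add_apply]
    split_ifs <;> simp
  · filter_upwards [hne] with φ hφ hsol
    exact absurd hsol (h _ hφ)
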